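/- arXiv:2602.08791 — 3 statements merged into one kernel-verified Lean document; each statement's English description precedes it below -/
import Mathlib

section
/- Let d ≥ 1, γ > 0, let f : ℝ → ℝ be twice continuously differentiable, let m, α : ℝ → ℝ be continuously differentiable with m ≥ 0 and α ≥ 0, and let φ, μ, p : ℝ × ℝ^d → ℝ and v : ℝ × ℝ^d → ℝ^d be smooth and ℤ^d-periodic in the spatial variable. Suppose the Cahn–Hilliard–Darcy system holds on ℝ × ℝ^d: ∂_t φ + div(φ v) = div( m(φ) ∇μ ), μ = −γ Δφ + f′(φ), α(φ) v + ∇p + div( γ ∇φ ⊗ ∇φ ) = 0, and div(v) = 0. Then for every t the energy E₀(φ(t)) = ∫_Ω ( (γ/2)|∇φ(t,x)|² + f(φ(t,x)) ) dx over the unit cube Ω = [0,1]^d satisfies d/dt E₀(φ(t)) = − ∫_Ω α(φ) |v|² dx − ∫_Ω m(φ) |∇μ|² dx ≤ 0. -/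
open MeasureTheory

/-- The `i`-th partial derivative of a function `g : ℝ^d → ℝ`. -/
noncomputable def pderiv {d : ℕ} (g : (Fin d → ℝ) → ℝ) (i : Fin d) (x : Fin d → ℝ) : ℝ :=
  fderiv ℝ g x (Pi.single i 1)

/-- `ℤ^d`-periodicity of a function on `ℝ^d`. -/
def ZdPeriodic {d : ℕ} {E : Type*} (g : (Fin d → ℝ) → E) : Prop :=
  ∀ (x : Fin d → ℝ) (k : Fin d → ℤ), g (x + fun i => (k i : ℝ)) = g x

section DirectionalDerivative

variable {E : Type*} [NormedAddCommGroup E] [NormedSpace ℝ E]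

/-- The derivative of `g` in the direction `w`. -/
noncomputable def dirDeriv (w : E) (g : E → ℝ) (q : E) : ℝ :=
  fderiv ℝ g q w

lemma dirDeriv_add {w q : E} {g h : E → ℝ} (hg : DifferentiableAt ℝ g q)
    (hh : DifferentiableAt ℝ h q) :
    dirDeriv w (fun y => g y + h y) q = dirDeriv w g q + dirDeriv w h q := by
  simp [dirDeriv, fderiv_fun_add hg hh]

lemma dirDeriv_sub {w q : E} {g h : E → ℝ} (hg : DifferentiableAt ℝ g q)
    (hh : DifferentiableAt ℝ h q) :
    dirDeriv w (fun y => g y - h y) q = dirDeriv w g q - dirDeriv w h q := by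
  simp [dirDeriv, fderiv_fun_sub hg hh]

lemma dirDeriv_mul {w q : E} {g h : E → ℝ} (hg : DifferentiableAt ℝ g q)
    (hh : DifferentiableAt ℝ h q) :
    dirDeriv w (fun y => g y * h y) q = dirDeriv w g q * h q + g q * dirDeriv w h q := by
  simp [dirDeriv, fderiv_fun_mul hg hh]
  ring

lemma dirDeriv_const_mul {w q : E} {g : E → ℝ} (c : ℝ) (hg : DifferentiableAt ℝ g q) :
    dirDeriv w (fun y => c * g y) q = c * dirDeriv w g q := by
  simp [dirDeriv, fderiv_const_mul hg]

lemma dirDeriv_sum_sq {ι : Type*} [Fintype ι] {w q : E} {g : ι → E → ℝ}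
    (hg : ∀ i, DifferentiableAt ℝ (g i) q) :
    dirDeriv w (fun y => ∑ i, g i y ^ 2) q = ∑ i, 2 * (g i q * dirDeriv w (g i) q) := by
  have h : HasFDerivAt (fun y => ∑ i, g i y ^ 2) _ q :=
    HasFDerivAt.fun_sum fun i _ => (hg i).hasFDerivAt.pow 2
  simp [dirDeriv, h.fderiv, mul_assoc]

lemma dirDeriv_comp {w q : E} {f : ℝ → ℝ} {g : E → ℝ} (hf : DifferentiableAt ℝ f (g q))
    (hg : DifferentiableAt ℝ g q) :
    dirDeriv w (fun y => f (g y)) q = deriv f (g q) * dirDeriv w g q := by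
  have h := hf.hasDerivAt.comp_hasFDerivAt q hg.hasFDerivAt
  have h' : fderiv ℝ (fun y => f (g y)) q = deriv f (g q) • fderiv ℝ g q := h.fderiv
  simp [dirDeriv, h']

lemma dirDeriv_comm {g : E → ℝ} (hg : ContDiff ℝ 2 g) (u w q : E) :
    dirDeriv u (dirDeriv w g) q = dirDeriv w (dirDeriv u g) q := by
  have hd : DifferentiableAt ℝ (fderiv ℝ g) q :=
    ((hg.fderiv_right (m := 1) (by norm_num)).differentiable (by norm_num)) q
  have hs : IsSymmSndFDerivAt ℝ g q := hg.contDiffAt.isSymmSndFDerivAt (by simp)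
  have key : ∀ a b : E, dirDeriv a (dirDeriv b g) q = fderiv ℝ (fderiv ℝ g) q a b := by
    intro a b
    have h := hd.hasFDerivAt.clm_apply (hasFDerivAt_const b q)
    have h' : fderiv ℝ (dirDeriv b g) q = _ := h.fderiv
    simp [dirDeriv, h']
  rw [key, key, hs]

lemma ContDiff.dirDeriv {n k : WithTop ℕ∞} {g : E → ℝ} (hg : ContDiff ℝ n g) (hk : k + 1 ≤ n)
    (w : E) : ContDiff ℝ k (dirDeriv w g) :=
  (hg.fderiv_right hk).clm_apply contDiff_const

lemma dirDeriv_add_period {g : E → ℝ} {c : E} (hg : ∀ q, g (q + c) = g q) (w q : E) :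
    dirDeriv w g (q + c) = dirDeriv w g q := by
  have h := fderiv_comp_add_right (𝕜 := ℝ) (f := g) (x := q) c
  simp only [hg] at h
  simp only [dirDeriv]
  rw [h]

end DirectionalDerivative

section EnergyBalance

variable {E : Type*} [NormedAddCommGroup E] [NormedSpace ℝ E] {ι : Type*} [Fintype ι]

/-- The Cahn–Hilliard free energy density, with `e i` the spatial directions. -/
noncomputable def energyDensity (γ : ℝ) (f : ℝ → ℝ) (e : ι → E) (φ : E → ℝ) (q : E) : ℝ :=
  γ / 2 * ∑ i, dirDeriv (e i) φ q ^ 2 + f (φ q)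

/-- The flux in the local energy balance of the Cahn–Hilliard–Darcy system, with `τ` the time
direction and `e i` the spatial directions. -/
noncomputable def energyFlux (γ : ℝ) (f m : ℝ → ℝ) (τ : E) (e : ι → E) (φ μ p : E → ℝ)
    (v : E → ι → ℝ) (i : ι) (q : E) : ℝ :=
  γ * (dirDeriv τ φ q * dirDeriv (e i) φ q) + μ q * (m (φ q) * dirDeriv (e i) μ q) -
    (p q + energyDensity γ f e φ q) * v q i

variable {γ : ℝ} {f m α : ℝ → ℝ} {τ : E} {e : ι → E} {φ μ p : E → ℝ} {v : E → ι → ℝ}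

lemma contDiff_energyDensity (hf : ContDiff ℝ 1 f) (hφ : ContDiff ℝ 2 φ) :
    ContDiff ℝ 1 (energyDensity γ f e φ) := by
  have h := fun i => hφ.dirDeriv (k := 1) (by norm_num) (e i)
  exact (contDiff_const.mul (ContDiff.sum fun i _ => (h i).pow 2)).add
    (hf.comp (hφ.of_le (by norm_num)))

lemma contDiff_energyFlux (hf : ContDiff ℝ 1 f) (hm : ContDiff ℝ 1 m) (hφ : ContDiff ℝ 2 φ)
    (hμ : ContDiff ℝ 2 μ) (hp : ContDiff ℝ 1 p) (hv : ContDiff ℝ 1 v) (i : ι) :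
    ContDiff ℝ 1 (energyFlux γ f m τ e φ μ p v i) := by
  have h := fun w => hφ.dirDeriv (k := 1) (by norm_num) w
  have h' := fun w => hμ.dirDeriv (k := 1) (by norm_num) w
  have hφ1 : ContDiff ℝ 1 φ := hφ.of_le (by norm_num)
  have hμ1 : ContDiff ℝ 1 μ := hμ.of_le (by norm_num)
  exact ((contDiff_const.mul ((h τ).mul (h (e i)))).add
    (hμ1.mul ((hm.comp hφ1).mul (h' (e i))))).sub
      ((hp.add (contDiff_energyDensity hf hφ)).mul (contDiff_pi.1 hv i))

lemma dirDeriv_energyDensity (hf : ContDiff ℝ 1 f) (hφ : ContDiff ℝ 2 φ) (w q : E) :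
    dirDeriv w (energyDensity γ f e φ) q =
      γ * ∑ i, dirDeriv (e i) φ q * dirDeriv w (dirDeriv (e i) φ) q +
        deriv f (φ q) * dirDeriv w φ q := by
  have h := fun i => (hφ.dirDeriv (k := 1) (by norm_num) (e i)).differentiable (by norm_num) q
  have hφd := hφ.differentiable (by norm_num) q
  have hfd := hf.differentiable (by norm_num) (φ q)
  have hfφ : DifferentiableAt ℝ (fun y => f (φ y)) q := hfd.comp q hφd
  have hsum : DifferentiableAt ℝ (fun y => ∑ i, dirDeriv (e i) φ y ^ 2) q :=
    DifferentiableAt.fun_sum fun i _ => (h i).pow 2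
  unfold energyDensity
  rw [dirDeriv_add (hsum.const_mul _) hfφ, dirDeriv_const_mul _ hsum,
    dirDeriv_sum_sq h, dirDeriv_comp hfd hφd, ← Finset.mul_sum]
  ring

/-- Local form of the energy law: the energy density changes by the divergence of a flux minus
the dissipation. -/
lemma dirDeriv_energyDensity_eq (hf : ContDiff ℝ 1 f) (hm : ContDiff ℝ 1 m)
    (hφ : ContDiff ℝ 2 φ) (hμ : ContDiff ℝ 2 μ) (hp : ContDiff ℝ 1 p) (hv : ContDiff ℝ 1 v)
    (q : E)
    (hpde : dirDeriv τ φ q + ∑ i, dirDeriv (e i) (fun y => φ y * v y i) q =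
      ∑ i, dirDeriv (e i) (fun y => m (φ y) * dirDeriv (e i) μ y) q)
    (hchem : μ q = -γ * ∑ i, dirDeriv (e i) (dirDeriv (e i) φ) q + deriv f (φ q))
    (hdarcy : ∀ i, α (φ q) * v q i + dirDeriv (e i) p q +
      ∑ j, dirDeriv (e j) (fun y => γ * dirDeriv (e i) φ y * dirDeriv (e j) φ y) q = 0)
    (hdiv : ∑ i, dirDeriv (e i) (fun y => v y i) q = 0) :
    dirDeriv τ (energyDensity γ f e φ) q =
      ∑ i, dirDeriv (e i) (energyFlux γ f m τ e φ μ p v i) q -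
        α (φ q) * ∑ i, v q i ^ 2 - m (φ q) * ∑ i, dirDeriv (e i) μ q ^ 2 := by
  have hDφ := fun w => (hφ.dirDeriv (k := 1) (by norm_num) w).differentiable (by norm_num) q
  have hDμ := fun w => (hμ.dirDeriv (k := 1) (by norm_num) w).differentiable (by norm_num) q
  have hφd := hφ.differentiable (by norm_num) q
  have hμd := hμ.differentiable (by norm_num) q
  have hpd := hp.differentiable (by norm_num) q
  have hmd : DifferentiableAt ℝ (fun y => m (φ y)) q :=
    (hm.differentiable (by norm_num) (φ q)).comp q hφd
  have hvd := fun i => (contDiff_pi.1 hv i).differentiable (by norm_num) q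
  have hed := (contDiff_energyDensity (γ := γ) (e := e) hf hφ).differentiable (by norm_num) q
  have hflux : ∀ i, dirDeriv (e i) (energyFlux γ f m τ e φ μ p v i) q =
      γ * (dirDeriv (e i) (dirDeriv τ φ) q * dirDeriv (e i) φ q +
          dirDeriv τ φ q * dirDeriv (e i) (dirDeriv (e i) φ) q) +
        (dirDeriv (e i) μ q * (m (φ q) * dirDeriv (e i) μ q) +
          μ q * dirDeriv (e i) (fun y => m (φ y) * dirDeriv (e i) μ y) q) -
        ((dirDeriv (e i) p q + dirDeriv (e i) (energyDensity γ f e φ) q) * v q i +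
          (p q + energyDensity γ f e φ q) * dirDeriv (e i) (fun y => v y i) q) := by
    intro i
    unfold energyFlux
    have h1 := (hDφ τ).fun_mul (hDφ (e i))
    have h2 := hmd.fun_mul (hDμ (e i))
    rw [dirDeriv_sub ((h1.const_mul γ).fun_add (hμd.fun_mul h2))
        ((hpd.fun_add hed).fun_mul (hvd i)),
      dirDeriv_add (h1.const_mul γ) (hμd.fun_mul h2), dirDeriv_const_mul γ h1,
      dirDeriv_mul (hDφ τ) (hDφ (e i)), dirDeriv_mul hμd h2,
      dirDeriv_mul (hpd.fun_add hed) (hvd i), dirDeriv_add hpd hed]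
  have hforce : ∀ i, dirDeriv (e i) p q + dirDeriv (e i) (energyDensity γ f e φ) q =
      μ q * dirDeriv (e i) φ q - α (φ q) * v q i := by
    intro i
    have hstress : ∑ j, dirDeriv (e j)
        (fun y => γ * dirDeriv (e i) φ y * dirDeriv (e j) φ y) q =
        γ * ∑ j, dirDeriv (e j) φ q * dirDeriv (e i) (dirDeriv (e j) φ) q +
          γ * dirDeriv (e i) φ q * ∑ j, dirDeriv (e j) (dirDeriv (e j) φ) q := by
      rw [Finset.mul_sum, Finset.mul_sum, ← Finset.sum_add_distrib]
      refine Finset.sum_congr rfl fun j _ => ?_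
      rw [dirDeriv_mul ((hDφ (e i)).const_mul γ) (hDφ (e j)), dirDeriv_const_mul γ (hDφ (e i)),
        dirDeriv_comm hφ (e j) (e i)]
      ring
    have h := hdarcy i
    rw [hstress] at h
    rw [dirDeriv_energyDensity hf hφ, hchem]
    linear_combination h
  have hconv : ∑ i, dirDeriv (e i) (fun y => φ y * v y i) q =
      ∑ i, dirDeriv (e i) φ q * v q i := by
    simp only [dirDeriv_mul hφd (hvd _), Finset.sum_add_distrib, ← Finset.mul_sum, hdiv]
    ring
  have hsum : ∑ i, dirDeriv (e i) (energyFlux γ f m τ e φ μ p v i) q =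
      γ * ∑ i, dirDeriv (e i) φ q * dirDeriv τ (dirDeriv (e i) φ) q +
        γ * dirDeriv τ φ q * ∑ i, dirDeriv (e i) (dirDeriv (e i) φ) q +
        m (φ q) * ∑ i, dirDeriv (e i) μ q ^ 2 +
        μ q * ∑ i, dirDeriv (e i) (fun y => m (φ y) * dirDeriv (e i) μ y) q -
        μ q * ∑ i, dirDeriv (e i) φ q * v q i + α (φ q) * ∑ i, v q i ^ 2 -
        (p q + energyDensity γ f e φ q) * ∑ i, dirDeriv (e i) (fun y => v y i) q := by
    simp only [Finset.mul_sum, ← Finset.sum_add_distrib, ← Finset.sum_sub_distrib]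
    refine Finset.sum_congr rfl fun i _ => ?_
    rw [hflux, hforce, dirDeriv_comm hφ (e i) τ]
    ring
  rw [hsum, hdiv, ← hpde, hconv, dirDeriv_energyDensity hf hφ]
  linear_combination (-dirDeriv τ φ q) * hchem

lemma energyFlux_add_period {c : E} (hφ : ∀ q, φ (q + c) = φ q) (hμ : ∀ q, μ (q + c) = μ q)
    (hp : ∀ q, p (q + c) = p q) (hv : ∀ q, v (q + c) = v q) (i : ι) (q : E) :
    energyFlux γ f m τ e φ μ p v i (q + c) = energyFlux γ f m τ e φ μ p v i q := by
  simp only [energyFlux, energyDensity, dirDeriv_add_period hφ, dirDeriv_add_period hμ, hφ, hμ,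
    hp, hv]

end EnergyBalance

lemma pderiv_slice {d : ℕ} {g : ℝ × (Fin d → ℝ) → ℝ} (hg : Differentiable ℝ g) (t : ℝ) (i : Fin d)
    (x : Fin d → ℝ) :
    pderiv (fun y => g (t, y)) i x = dirDeriv ((0, Pi.single i 1) : ℝ × (Fin d → ℝ)) g (t, x) := by
  have h := (hg (t, x)).hasFDerivAt.comp x (hasFDerivAt_prodMk_right t x)
  have h' : fderiv ℝ (fun y => g (t, y)) x = _ := h.fderiv
  simp [pderiv, dirDeriv, h']

lemma hasDerivAt_time_slice {d : ℕ} {g : ℝ × (Fin d → ℝ) → ℝ} (hg : Differentiable ℝ g) (t : ℝ)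
    (x : Fin d → ℝ) :
    HasDerivAt (fun s => g (s, x)) (dirDeriv ((1, 0) : ℝ × (Fin d → ℝ)) g (t, x)) t := by
  have h := (hg (t, x)).hasFDerivAt.comp_hasDerivAt t
    ((hasDerivAt_id t).prodMk (hasDerivAt_const t x))
  simpa [dirDeriv, Function.comp_def] using h

/-- The divergence of a periodic vector field integrates to zero over the unit cube. -/
lemma integral_sum_pderiv_eq_zero {d : ℕ} (F : Fin d → (Fin d → ℝ) → ℝ)
    (hF : ∀ i, ContDiff ℝ 1 (F i)) (hper : ∀ i, ZdPeriodic (F i)) :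
    ∫ x in Set.Icc (0 : Fin d → ℝ) 1, ∑ i, pderiv (F i) i x = 0 := by
  rcases d with _ | n
  · simp
  have hcont : Continuous fun x => ∑ i, pderiv (F i) i x :=
    continuous_finsetSum _ fun i _ =>
      ((hF i).continuous_fderiv (by norm_num)).clm_apply continuous_const
  have h := integral_divergence_of_hasFDerivAt_off_countable' (0 : Fin (n + 1) → ℝ) 1
    zero_le_one F (fun i x => fderiv ℝ (F i) x) ∅ Set.countable_empty
    (fun i => (hF i).continuous.continuousOn)
    (fun x _ i => ((hF i).differentiable (by norm_num) x).hasFDerivAt)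
    (hcont.integrableOn_Icc)
  refine h.trans (Finset.sum_eq_zero fun i _ => sub_eq_zero.2 ?_)
  congr 1
  funext x
  rw [← hper i (i.insertNth ((0 : Fin (n + 1) → ℝ) i) x) (Pi.single i 1)]
  congr 1
  funext j
  refine Fin.succAboveCases i ?_ (fun k => ?_) j <;> simp

/-- Differentiation under the integral sign over the unit cube. -/
lemma hasDerivAt_integral_Icc {d : ℕ} {g : ℝ × (Fin d → ℝ) → ℝ} (hg : ContDiff ℝ 1 g) (t : ℝ) :
    HasDerivAt (fun s => ∫ x in Set.Icc (0 : Fin d → ℝ) 1, g (s, x))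
      (∫ x in Set.Icc (0 : Fin d → ℝ) 1, dirDeriv ((1, 0) : ℝ × (Fin d → ℝ)) g (t, x)) t := by
  have hD : Continuous (dirDeriv ((1, 0) : ℝ × (Fin d → ℝ)) g) :=
    (hg.dirDeriv (k := 0) (by norm_num) _).continuous
  obtain ⟨C, hC⟩ := ((isCompact_closedBall t 1).prod
    (isCompact_Icc (a := (0 : Fin d → ℝ)) (b := 1))).exists_bound_of_continuousOn hD.continuousOn
  have hslice : ∀ {h : ℝ × (Fin d → ℝ) → ℝ}, Continuous h → ∀ s, Continuous fun x => h (s, x) :=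
    fun hh s => hh.comp (Continuous.prodMk_right s)
  refine (hasDerivAt_integral_of_dominated_loc_of_deriv_le (bound := fun _ => C)
    (F' := fun s x => dirDeriv (1, 0) g (s, x))
    (Metric.closedBall_mem_nhds t one_pos) (.of_forall fun s =>
      (hslice hg.continuous s).aestronglyMeasurable)
    (hslice hg.continuous t).integrableOn_Icc (hslice hD t).aestronglyMeasurable
    ?_ ?_ ?_).2
  · filter_upwards [ae_restrict_mem measurableSet_Icc] with x hx s hs
    exact hC (s, x) ⟨hs, hx⟩
  · exact integrableOn_const isCompact_Icc.measure_lt_top.ne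
  · exact .of_forall fun x s _ => hasDerivAt_time_slice (hg.differentiable (by norm_num)) s x

/-- Energy dissipation for the Cahn–Hilliard–Darcy system with `ℤ^d`-periodic data:
`d/dt E₀(φ(t)) = −∫_Ω α(φ)|v|² dx − ∫_Ω m(φ)|∇μ|² dx ≤ 0`
over the unit cube `Ω = [0,1]^d`. -/
theorem CHD_energy_dissipation (d : ℕ) (hd : 1 ≤ d) (γ : ℝ) (hγ : 0 < γ)
    (f : ℝ → ℝ) (hf : ContDiff ℝ 2 f)
    (m α : ℝ → ℝ) (hm : ContDiff ℝ 1 m) (hα : ContDiff ℝ 1 α)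
    (hm0 : ∀ s : ℝ, 0 ≤ m s) (hα0 : ∀ s : ℝ, 0 ≤ α s)
    (φ μ p : ℝ × (Fin d → ℝ) → ℝ) (v : ℝ × (Fin d → ℝ) → Fin d → ℝ)
    (hφ : ContDiff ℝ (⊤ : ℕ∞) φ) (hμ : ContDiff ℝ (⊤ : ℕ∞) μ) (hp : ContDiff ℝ (⊤ : ℕ∞) p)
    (hv : ContDiff ℝ (⊤ : ℕ∞) v)
    (hφper : ∀ t : ℝ, ZdPeriodic fun x => φ (t, x))
    (hμper : ∀ t : ℝ, ZdPeriodic fun x => μ (t, x))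
    (hpper : ∀ t : ℝ, ZdPeriodic fun x => p (t, x))
    (hvper : ∀ t : ℝ, ZdPeriodic fun x => v (t, x))
    (hpde : ∀ (t : ℝ) (x : Fin d → ℝ),
      deriv (fun s => φ (s, x)) t +
        ∑ i, pderiv (fun y => φ (t, y) * v (t, y) i) i x =
        ∑ i, pderiv (fun y => m (φ (t, y)) * pderiv (fun z => μ (t, z)) i y) i x)
    (hchem : ∀ (t : ℝ) (x : Fin d → ℝ),
      μ (t, x) =
        -γ * ∑ i, pderiv (pderiv (fun z => φ (t, z)) i) i x + deriv f (φ (t, x)))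
    (hdarcy : ∀ (t : ℝ) (x : Fin d → ℝ) (i : Fin d),
      α (φ (t, x)) * v (t, x) i + pderiv (fun z => p (t, z)) i x +
        ∑ j, pderiv
          (fun y => γ * pderiv (fun z => φ (t, z)) i y * pderiv (fun z => φ (t, z)) j y)
          j x = 0)
    (hdiv : ∀ (t : ℝ) (x : Fin d → ℝ),
      ∑ i, pderiv (fun y => v (t, y) i) i x = 0) :
    ∀ t : ℝ,
      HasDerivAt
        (fun s => ∫ x in Set.Icc (0 : Fin d → ℝ) 1,
          (γ / 2 * ∑ i, (pderiv (fun z => φ (s, z)) i x) ^ 2 + f (φ (s, x))))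
        (-(∫ x in Set.Icc (0 : Fin d → ℝ) 1,
            α (φ (t, x)) * ∑ i, (v (t, x) i) ^ 2) -
          ∫ x in Set.Icc (0 : Fin d → ℝ) 1,
            m (φ (t, x)) * ∑ i, (pderiv (fun z => μ (t, z)) i x) ^ 2) t ∧
      (-(∫ x in Set.Icc (0 : Fin d → ℝ) 1,
            α (φ (t, x)) * ∑ i, (v (t, x) i) ^ 2) -
          ∫ x in Set.Icc (0 : Fin d → ℝ) 1,
            m (φ (t, x)) * ∑ i, (pderiv (fun z => μ (t, z)) i x) ^ 2) ≤ 0 := by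
  have hφ2 : ContDiff ℝ 2 φ := contDiff_infty.1 hφ 2
  have hμ2 : ContDiff ℝ 2 μ := contDiff_infty.1 hμ 2
  have hp1 : ContDiff ℝ 1 p := (contDiff_infty.1 hp 1).of_le (by norm_num)
  have hv1 : ContDiff ℝ 1 v := (contDiff_infty.1 hv 1).of_le (by norm_num)
  have hf1 : ContDiff ℝ 1 f := hf.of_le (by norm_num)
  let e : Fin d → ℝ × (Fin d → ℝ) := fun i => (0, Pi.single i 1)
  have hDφ := fun w => hφ2.dirDeriv (k := 1) (by norm_num) w
  have hDμ := fun w => hμ2.dirDeriv (k := 1) (by norm_num) w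
  have hφ1 : ContDiff ℝ 1 φ := hφ2.of_le (by norm_num)
  have hμ1 : ContDiff ℝ 1 μ := hμ2.of_le (by norm_num)
  have slice : ∀ {g : ℝ × (Fin d → ℝ) → ℝ}, ContDiff ℝ 1 g → ∀ t i,
      pderiv (fun y => g (t, y)) i = fun x => dirDeriv (e i) g (t, x) :=
    fun hg t i => funext fun x => pderiv_slice (hg.differentiable (by norm_num)) t i x
  have hcont : ∀ {g : ℝ × (Fin d → ℝ) → ℝ}, Continuous g → ∀ t, Continuous fun x => g (t, x) :=
    fun hh t => hh.comp (Continuous.prodMk_right t)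
  intro t
  have hbalance : ∀ x, dirDeriv (1, 0) (energyDensity γ f e φ) (t, x) =
      ∑ i, pderiv (fun y => energyFlux γ f m (1, 0) e φ μ p v i (t, y)) i x -
        α (φ (t, x)) * ∑ i, v (t, x) i ^ 2 -
        m (φ (t, x)) * ∑ i, dirDeriv (e i) μ (t, x) ^ 2 := by
    intro x
    have hmDμ : ∀ i, ContDiff ℝ 1 fun q => m (φ q) * dirDeriv (e i) μ q :=
      fun i => (hm.comp hφ1).mul (hDμ (e i))
    have h1 := hpde t x
    have h2 := hchem t x
    have h3 := hdarcy t x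
    have h4 := hdiv t x
    rw [(hasDerivAt_time_slice (hφ1.differentiable (by norm_num)) t x).deriv] at h1
    simp only [slice hφ1, slice hμ1, slice hp1, slice (hDφ _),
      slice (hφ1.mul (contDiff_pi.1 hv1 _)), slice (contDiff_pi.1 hv1 _),
      slice (hmDμ _),
      slice ((contDiff_const.mul (hDφ _)).mul (hDφ _))] at h1 h2 h3 h4
    simp only [slice (contDiff_energyFlux hf1 hm hφ2 hμ2 hp1 hv1 _)]
    exact dirDeriv_energyDensity_eq hf1 hm hφ2 hμ2 hp1 hv1 (t, x) h1 h2 h3 h4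
  have hflux1 := contDiff_energyFlux (γ := γ) (τ := ((1, 0) : ℝ × (Fin d → ℝ))) (e := e)
    hf1 hm hφ2 hμ2 hp1 hv1
  have hfluxper : ∀ i, ZdPeriodic
      fun y => energyFlux γ f m (1, 0) e φ μ p v i (t, y) := by
    intro i x k
    have h := energyFlux_add_period (γ := γ) (f := f) (m := m)
      (τ := ((1, 0) : ℝ × (Fin d → ℝ))) (e := e) (φ := φ) (μ := μ) (p := p) (v := v)
      (c := (0, fun i => (k i : ℝ)))
      (fun q => by simpa [Prod.add_def] using hφper q.1 q.2 k) (fun q => by simpa [Prod.add_def] using hμper q.1 q.2 k)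
      (fun q => by simpa [Prod.add_def] using hpper q.1 q.2 k) (fun q => by simpa [Prod.add_def] using hvper q.1 q.2 k)
      i (t, x)
    simpa using h
  have hzero := integral_sum_pderiv_eq_zero
    (fun i y => energyFlux γ f m (1, 0) e φ μ p v i (t, y))
    (fun i => (hflux1 i).comp (contDiff_prodMk_right t)) hfluxper
  have hderiv := hasDerivAt_integral_Icc (contDiff_energyDensity (γ := γ) (e := e) hf1 hφ2) t
  have hint1 : IntegrableOn
      (fun x => ∑ i, pderiv (fun y => energyFlux γ f m (1, 0) e φ μ p v i (t, y)) i x)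
      (Set.Icc (0 : Fin d → ℝ) 1) := by
    simp only [slice (hflux1 _)]
    exact (continuous_finsetSum _ fun i _ => hcont
      ((hflux1 i).dirDeriv (k := 0) (by norm_num) (e i)).continuous t).integrableOn_Icc
  have hint2 : IntegrableOn (fun x => α (φ (t, x)) * ∑ i, v (t, x) i ^ 2)
      (Set.Icc (0 : Fin d → ℝ) 1) :=
    (hcont ((hα.continuous.comp hφ.continuous).mul (continuous_finsetSum _ fun i _ =>
      ((continuous_pi_iff.1 hv.continuous) i).pow 2)) t).integrableOn_Icc
  have hint3 : IntegrableOn (fun x => m (φ (t, x)) * ∑ i, dirDeriv (e i) μ (t, x) ^ 2)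
      (Set.Icc (0 : Fin d → ℝ) 1) :=
    (hcont ((hm.continuous.comp hφ.continuous).mul (continuous_finsetSum _ fun i _ =>
      (hDμ (e i)).continuous.pow 2)) t).integrableOn_Icc
  simp only [slice hφ1, slice hμ1]
  constructor
  · simp only [hbalance] at hderiv
    rw [integral_sub (hint1.fun_sub hint2) hint3, integral_sub hint1 hint2, hzero, zero_sub] at hderiv
    exact hderiv
  · have h1 : 0 ≤ ∫ x in Set.Icc (0 : Fin d → ℝ) 1, α (φ (t, x)) * ∑ i, v (t, x) i ^ 2 :=
      integral_nonneg fun x => mul_nonneg (hα0 _) (Finset.sum_nonneg fun i _ => sq_nonneg _)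
    have h2 : 0 ≤ ∫ x in Set.Icc (0 : Fin d → ℝ) 1,
        m (φ (t, x)) * ∑ i, dirDeriv (e i) μ (t, x) ^ 2 :=
      integral_nonneg fun x => mul_nonneg (hm0 _) (Finset.sum_nonneg fun i _ => sq_nonneg _)
    linarith
end

section
/- Let d ≥ 1, γ ∈ ℝ, let f : ℝ → ℝ be continuously differentiable, let φ : ℝ^d → ℝ be three times continuously differentiable and ℤ^d-periodic, and let v : ℝ^d → ℝ^d be continuously differentiable, ℤ^d-periodic, and divergence free (div v = 0). Set μ := −γ Δφ + f′(φ). Then ∫_Ω div( γ ∇φ ⊗ ∇φ ) · v dx = − ∫_Ω μ ∇φ · v dx, where Ω = [0,1]^d is the unit cube. -/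
open MeasureTheory

lemma ContDiff.pderiv {d : ℕ} {g : (Fin d → ℝ) → ℝ} {m n : WithTop ℕ∞} (hg : ContDiff ℝ n g)
    (hmn : m + 1 ≤ n) (i : Fin d) : ContDiff ℝ m (pderiv g i) :=
  (hg.fderiv_right hmn).clm_apply contDiff_const

lemma ZdPeriodic.pderiv {d : ℕ} {g : (Fin d → ℝ) → ℝ} (hg : ZdPeriodic g) (i : Fin d) :
    ZdPeriodic (pderiv g i) := by
  intro x k
  have h : (fun y => g (y + fun i => (k i : ℝ))) = g := funext fun y => hg y k
  unfold _root_.pderiv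
  rw [← fderiv_comp_add_right, h]

lemma pderiv_comm {d : ℕ} {g : (Fin d → ℝ) → ℝ} (hg : ContDiff ℝ 2 g) (i j : Fin d)
    (x : Fin d → ℝ) : pderiv (pderiv g i) j x = pderiv (pderiv g j) i x := by
  have hd : DifferentiableAt ℝ (fderiv ℝ g) x :=
    (hg.fderiv_right (m := 1) (by norm_num)).differentiable (by norm_num) x
  have h : ∀ a b : Fin d, pderiv (pderiv g a) b x =
      fderiv ℝ (fderiv ℝ g) x (Pi.single b 1) (Pi.single a 1) := by
    intro a b
    change fderiv ℝ (fun y => fderiv ℝ g y (Pi.single a 1)) x (Pi.single b 1) = _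
    rw [fderiv_clm_apply hd (differentiableAt_const _)]
    simp
  rw [h, h]
  exact (hg.contDiffAt.isSymmSndFDerivAt (by simp)).eq _ _

lemma pderiv_mul {d : ℕ} {g h : (Fin d → ℝ) → ℝ} {x : Fin d → ℝ} (hg : DifferentiableAt ℝ g x)
    (hh : DifferentiableAt ℝ h x) (i : Fin d) :
    pderiv (fun y => g y * h y) i x = pderiv g i x * h x + g x * pderiv h i x := by
  unfold pderiv
  rw [fderiv_fun_mul hg hh]
  simp
  ring

/-- The divergence of a periodic `C¹` vector field has zero integral over the unit cube. -/
lemma ZdPeriodic.integral_divergence_eq_zero {d : ℕ} (F : Fin d → (Fin d → ℝ) → ℝ)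
    (hF : ∀ i, ContDiff ℝ 1 (F i)) (hper : ∀ i, ZdPeriodic (F i)) :
    ∫ x in Set.Icc (0 : Fin d → ℝ) 1, ∑ i, _root_.pderiv (F i) i x = 0 := by
  cases d with
  | zero => simp
  | succ n =>
    have hcont : Continuous fun x => ∑ i, _root_.pderiv (F i) i x :=
      continuous_finsetSum _ fun i _ => ((hF i).pderiv (m := 0) (by norm_num) i).continuous
    have key := integral_divergence_of_hasFDerivAt_off_countable' (0 : Fin (n + 1) → ℝ) 1
      zero_le_one F (fun i x => fderiv ℝ (F i) x) ∅ Set.countable_empty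
      (fun i => (hF i).continuous.continuousOn)
      (fun x _ i => ((hF i).differentiable (by norm_num) x).hasFDerivAt)
      (hcont.continuousOn.integrableOn_compact isCompact_Icc)
    refine key.trans (Finset.sum_eq_zero fun i _ => sub_eq_zero.2 ?_)
    congr 1
    funext y
    rw [← hper i (i.insertNth ((0 : Fin (n + 1) → ℝ) i) y) (Pi.single i 1)]
    congr 1
    funext j
    refine Fin.succAboveCases i ?_ (fun k => ?_) j
    · simp
    · simp [Fin.succAbove_ne]

/-- Weak Korteweg stress identity against periodic divergence-free fields:
with `μ = −γΔφ + f′(φ)`,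
`∫_Ω div(γ ∇φ ⊗ ∇φ) · v dx = −∫_Ω μ ∇φ · v dx` over the unit cube `Ω = [0,1]^d`. -/
theorem korteweg_weak_identity (d : ℕ) (hd : 1 ≤ d) (γ : ℝ)
    (f : ℝ → ℝ) (hf : ContDiff ℝ 1 f)
    (φ : (Fin d → ℝ) → ℝ) (hφ : ContDiff ℝ 3 φ) (hφper : ZdPeriodic φ)
    (v : (Fin d → ℝ) → Fin d → ℝ) (hv : ContDiff ℝ 1 v) (hvper : ZdPeriodic v)
    (hdiv : ∀ x : Fin d → ℝ, ∑ i, pderiv (fun y => v y i) i x = 0)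
    (μ : (Fin d → ℝ) → ℝ)
    (hμ : μ = fun x => -γ * ∑ i, pderiv (pderiv φ i) i x + deriv f (φ x)) :
    (∫ x in Set.Icc (0 : Fin d → ℝ) 1,
        ∑ i, (∑ j, pderiv (fun y => γ * pderiv φ i y * pderiv φ j y) j x) * v x i) =
      -(∫ x in Set.Icc (0 : Fin d → ℝ) 1,
          μ x * ∑ i, pderiv φ i x * v x i) := by
  have hφ1 : ∀ i, ContDiff ℝ 2 (pderiv φ i) := fun i => hφ.pderiv (by norm_num) i
  have hφ1' : ∀ i, ContDiff ℝ 1 (pderiv φ i) := fun i => (hφ1 i).of_le (by norm_num)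
  have hφd : ∀ i x, DifferentiableAt ℝ (pderiv φ i) x := fun i =>
    (hφ1 i).differentiable (by norm_num)
  have hφ2 : ∀ i j, Continuous (pderiv (pderiv φ i) j) := fun i j =>
    ((hφ1 i).pderiv (m := 1) (by norm_num) j).continuous
  have hφ0 : ContDiff ℝ 1 φ := hφ.of_le (by norm_num)
  have hv1 : ∀ i, ContDiff ℝ 1 fun y => v y i := contDiff_pi.1 hv
  have hstress : ∀ i j, ContDiff ℝ 1 fun y => γ * pderiv φ i y * pderiv φ j y := fun i j =>
    (contDiff_const.mul (hφ1' i)).mul (hφ1' j)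
  set G : (Fin d → ℝ) → ℝ := fun y => γ / 2 * ∑ j, pderiv φ j y * pderiv φ j y + f (φ y) with hG
  have hGC : ContDiff ℝ 1 G :=
    (contDiff_const.mul (ContDiff.sum fun j _ => (hφ1' j).mul (hφ1' j))).add (hf.comp hφ0)
  have hGper : ZdPeriodic G := by
    intro x k
    simp only [hG, hφper x k, fun j => hφper.pderiv j x k]
  have hGd : ∀ i x, pderiv G i x =
      γ * ∑ j, pderiv φ j x * pderiv (pderiv φ i) j x + deriv f (φ x) * pderiv φ i x := by
    intro i x
    have h1 : HasFDerivAt (fun y => ∑ j, pderiv φ j y * pderiv φ j y)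
        (∑ j, (pderiv φ j x • fderiv ℝ (pderiv φ j) x + pderiv φ j x • fderiv ℝ (pderiv φ j) x))
        x := HasFDerivAt.fun_sum fun j _ => (hφd j x).hasFDerivAt.mul (hφd j x).hasFDerivAt
    have h2 : HasFDerivAt (fun y => f (φ y)) (deriv f (φ x) • fderiv ℝ φ x) x :=
      ((hf.differentiable (by norm_num) (φ x)).hasDerivAt).comp_hasFDerivAt x
        (hφ0.differentiable (by norm_num) x).hasFDerivAt
    have h3 := ((h1.const_mul (γ / 2)).add h2).fderiv
    change fderiv ℝ G x = _ at h3
    rw [pderiv, h3]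
    simp only [add_apply, smul_apply,
      sum_apply, smul_eq_mul]
    congr 1
    rw [Finset.mul_sum, Finset.mul_sum]
    refine Finset.sum_congr rfl fun j _ => ?_
    rw [pderiv_comm (hφ.of_le (by norm_num)) i j x, pderiv.eq_1 (pderiv φ j) i x]
    ring
  have hA : Continuous fun x =>
      ∑ i, (∑ j, pderiv (fun y => γ * pderiv φ i y * pderiv φ j y) j x) * v x i :=
    continuous_finsetSum _ fun i _ => (continuous_finsetSum _ fun j _ =>
      ((hstress i j).pderiv (m := 0) (by norm_num) j).continuous).mul (hv1 i).continuous
  have hB : Continuous fun x => μ x * ∑ i, pderiv φ i x * v x i := by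
    subst hμ
    exact ((continuous_const.mul (continuous_finsetSum _ fun i _ => hφ2 i i)).add
      ((hf.continuous_deriv (by norm_num)).comp hφ.continuous)).mul
      (continuous_finsetSum _ fun i _ => (hφ1 i).continuous.mul (hv1 i).continuous)
  rw [← add_eq_zero_iff_eq_neg,
    ← integral_add (hA.continuousOn.integrableOn_compact isCompact_Icc)
      (hB.continuousOn.integrableOn_compact isCompact_Icc),
    ← ZdPeriodic.integral_divergence_eq_zero (fun i y => G y * v y i)
      (fun i => hGC.mul (hv1 i)) (fun i x k => by simp only [hGper x k, hvper x k])]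
  congr 1
  funext x
  have hdivGv : ∑ i, pderiv (fun y => G y * v y i) i x = ∑ i, pderiv G i x * v x i := by
    simp only [fun i => pderiv_mul (hGC.differentiable (by norm_num) x)
      ((hv1 i).differentiable (by norm_num) x) i]
    rw [Finset.sum_add_distrib, ← Finset.mul_sum, hdiv, mul_zero, add_zero]
  have hdivstress : ∀ i, ∑ j, pderiv (fun y => γ * pderiv φ i y * pderiv φ j y) j x =
      γ * ∑ j, pderiv φ j x * pderiv (pderiv φ i) j x +
        γ * (∑ j, pderiv (pderiv φ j) j x) * pderiv φ i x := by
    intro i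
    simp only [Finset.mul_sum, Finset.sum_mul, ← Finset.sum_add_distrib]
    refine Finset.sum_congr rfl fun j _ => ?_
    have hc : pderiv (fun y => γ * pderiv φ i y) j x = γ * pderiv (pderiv φ i) j x := by
      rw [pderiv, fderiv_const_mul (hφd i x)]
      rfl
    rw [pderiv_mul ((hφd i x).const_mul γ) (hφd j x), hc]
    ring
  rw [hdivGv, hμ, Finset.mul_sum, ← Finset.sum_add_distrib]
  refine Finset.sum_congr rfl fun i _ => ?_
  rw [hdivstress, hGd]
  ring
end

section
/- (Discrete energy dissipation for the Cahn–Hilliard scheme.) Let d ≥ 1, γ > 0, τ > 0, let f : ℝ → ℝ be continuously differentiable, let m : ℝ → ℝ be continuous with m ≥ 0, and let φⁿ, φⁿ⁺¹, μⁿ⁺¹ : ℝ^d → ℝ be continuously differentiable and ℤ^d-periodic. Define the time-averaged potential derivative F(a,b) := ∫₀¹ f′(b + s(a − b)) ds and set d_τφ := (φⁿ⁺¹ − φⁿ)/τ. Suppose: (i) ⟨ d_τφ, μⁿ⁺¹ ⟩ + ⟨ m(φⁿ⁺¹) ∇μⁿ⁺¹, ∇μⁿ⁺¹ ⟩ = 0,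 and (ii) ⟨ μⁿ⁺¹, d_τφ ⟩ − γ ⟨ ∇φⁿ⁺¹, ∇ d_τφ ⟩ − ⟨ F(φⁿ⁺¹, φⁿ), d_τφ ⟩ = 0, where ⟨·,·⟩ is the L² inner product over the unit cube Ω = [0,1]^d. Then E₀(φⁿ⁺¹) + τ ⟨ m(φⁿ⁺¹) ∇μⁿ⁺¹, ∇μⁿ⁺¹ ⟩ ≤ E₀(φⁿ), where E₀(φ) = ∫_Ω ( (γ/2)|∇φ|² + f(φ) ) dx. -/
open MeasureTheory

/-- The time-averaged potential derivative `F(a,b) = ∫₀¹ f′(b + s(a−b)) ds`. -/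
noncomputable def timeAvgF (f : ℝ → ℝ) (a b : ℝ) : ℝ :=
  ∫ s in (0:ℝ)..1, deriv f (b + s * (a - b))

theorem continuous_pderiv {d : ℕ} {g : (Fin d → ℝ) → ℝ} (hg : ContDiff ℝ 1 g) (i : Fin d) :
    Continuous (pderiv g i) :=
  (hg.continuous_fderiv one_ne_zero).clm_apply continuous_const

theorem pderiv_sub_div {d : ℕ} {g h : (Fin d → ℝ) → ℝ} (hg : Differentiable ℝ g)
    (hh : Differentiable ℝ h) (c : ℝ) (i : Fin d) (x : Fin d → ℝ) :
    pderiv (fun y => (g y - h y) / c) i x = (pderiv g i x - pderiv h i x) / c := by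
  have key := (((hg x).hasFDerivAt.sub (hh x).hasFDerivAt).const_smul c⁻¹).fderiv
  have e : (fun y => (g y - h y) / c) = c⁻¹ • (g - h) := by
    ext y; simp [div_eq_inv_mul]
  simp only [pderiv]
  rw [e, key]
  simp [div_eq_inv_mul]

theorem timeAvgF_mul_sub {f : ℝ → ℝ} (hf : ContDiff ℝ 1 f) (a b : ℝ) :
    timeAvgF f a b * (a - b) = f a - f b := by
  have hd : ∀ s ∈ Set.uIcc (0 : ℝ) 1, HasDerivAt (fun s => f (b + s * (a - b)))
      (deriv f (b + s * (a - b)) * (a - b)) s := fun s _ =>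
    ((hf.differentiable one_ne_zero _).hasDerivAt).comp s
      (by simpa using ((hasDerivAt_id s).mul_const (a - b)).const_add b)
  have hc : Continuous (deriv f) := hf.continuous_deriv le_rfl
  have := intervalIntegral.integral_eq_sub_of_hasDerivAt hd
    (Continuous.intervalIntegrable (by fun_prop) _ _)
  rw [timeAvgF, ← intervalIntegral.integral_mul_const, this]
  simp

/-- Discrete energy dissipation for the Cahn–Hilliard scheme:
`E₀(φⁿ⁺¹) + τ⟨m(φⁿ⁺¹)∇μⁿ⁺¹, ∇μⁿ⁺¹⟩ ≤ E₀(φⁿ)` over the unit cube `Ω = [0,1]^d`. -/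
theorem CH_discrete_energy_dissipation (d : ℕ) (hd : 1 ≤ d)
    (γ τ : ℝ) (hγ : 0 < γ) (hτ : 0 < τ)
    (f : ℝ → ℝ) (hf : ContDiff ℝ 1 f)
    (m : ℝ → ℝ) (hm : Continuous m) (hm0 : ∀ s : ℝ, 0 ≤ m s)
    (φn φn1 μn1 : (Fin d → ℝ) → ℝ)
    (hφn : ContDiff ℝ 1 φn) (hφn1 : ContDiff ℝ 1 φn1) (hμn1 : ContDiff ℝ 1 μn1)
    (hφnper : ZdPeriodic φn) (hφn1per : ZdPeriodic φn1) (hμn1per : ZdPeriodic μn1)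
    (hi : (∫ x in Set.Icc (0 : Fin d → ℝ) 1, (φn1 x - φn x) / τ * μn1 x) +
        (∫ x in Set.Icc (0 : Fin d → ℝ) 1,
          m (φn1 x) * ∑ i, (pderiv μn1 i x) ^ 2) = 0)
    (hii : (∫ x in Set.Icc (0 : Fin d → ℝ) 1, μn1 x * ((φn1 x - φn x) / τ)) -
        γ * (∫ x in Set.Icc (0 : Fin d → ℝ) 1,
          ∑ i, pderiv φn1 i x * pderiv (fun y => (φn1 y - φn y) / τ) i x) -
        (∫ x in Set.Icc (0 : Fin d → ℝ) 1,
          timeAvgF f (φn1 x) (φn x) * ((φn1 x - φn x) / τ)) = 0) :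
    (∫ x in Set.Icc (0 : Fin d → ℝ) 1,
        (γ / 2 * ∑ i, (pderiv φn1 i x) ^ 2 + f (φn1 x))) +
      τ * (∫ x in Set.Icc (0 : Fin d → ℝ) 1,
        m (φn1 x) * ∑ i, (pderiv μn1 i x) ^ 2) ≤
      ∫ x in Set.Icc (0 : Fin d → ℝ) 1,
        (γ / 2 * ∑ i, (pderiv φn i x) ^ 2 + f (φn x)) := by
  have hc1 := fun i => continuous_pderiv hφn1 i
  have hcn := fun i => continuous_pderiv hφn i
  have hfc := hf.continuous
  have hφc1 := hφn1.continuous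
  have hφcn := hφn.continuous
  have hint : ∀ {g : (Fin d → ℝ) → ℝ}, Continuous g →
      IntegrableOn g (Set.Icc (0 : Fin d → ℝ) 1) := fun hg =>
    hg.continuousOn.integrableOn_compact isCompact_Icc
  have hpd := pderiv_sub_div (hφn1.differentiable one_ne_zero) (hφn.differentiable one_ne_zero) τ
  have hF : ∀ x, timeAvgF f (φn1 x) (φn x) * ((φn1 x - φn x) / τ) =
      (f (φn1 x) - f (φn x)) / τ := fun x => by
    rw [← mul_div_assoc, timeAvgF_mul_sub hf]
  simp only [hpd, hF] at hii
  have hp : IntegrableOn (fun x => ∑ i, pderiv φn1 i x * ((pderiv φn1 i x - pderiv φn i x) / τ))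
      (Set.Icc (0 : Fin d → ℝ) 1) := hint (by fun_prop)
  have hq : IntegrableOn (fun x => (f (φn1 x) - f (φn x)) / τ)
      (Set.Icc (0 : Fin d → ℝ) 1) := hint (by fun_prop)
  have hE1 : IntegrableOn (fun x => γ / 2 * ∑ i, (pderiv φn1 i x) ^ 2 + f (φn1 x))
      (Set.Icc (0 : Fin d → ℝ) 1) := hint (by fun_prop)
  have hEn : IntegrableOn (fun x => γ / 2 * ∑ i, (pderiv φn i x) ^ 2 + f (φn x))
      (Set.Icc (0 : Fin d → ℝ) 1) := hint (by fun_prop)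
  have hle := integral_mono hE1 (hEn.add (((hp.const_mul γ).add hq).const_mul τ)) fun x => by
    have hsum : γ / 2 * ∑ i, (pderiv φn1 i x) ^ 2 ≤ γ / 2 * ∑ i, (pderiv φn i x) ^ 2 +
        τ * (γ * ∑ i, pderiv φn1 i x * ((pderiv φn1 i x - pderiv φn i x) / τ)) := by
      simp only [Finset.mul_sum, ← Finset.sum_add_distrib]
      refine Finset.sum_le_sum fun i _ => ?_
      have e : τ * (γ * (pderiv φn1 i x * ((pderiv φn1 i x - pderiv φn i x) / τ))) =
          γ * (pderiv φn1 i x * (pderiv φn1 i x - pderiv φn i x)) := by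
        field_simp
      rw [e]
      nlinarith [mul_nonneg hγ.le (sq_nonneg (pderiv φn1 i x - pderiv φn i x))]
    have e : τ * ((f (φn1 x) - f (φn x)) / τ) = f (φn1 x) - f (φn x) :=
      mul_div_cancel₀ _ hτ.ne'
    simp only [Pi.add_apply, mul_add]
    linarith
  rw [integral_add' hEn (((hp.const_mul γ).add hq).const_mul τ), integral_const_mul,
    integral_add' (hp.const_mul γ) hq, integral_const_mul] at hle
  simp only [mul_comm (μn1 _)] at hii
  rw [eq_neg_of_add_eq_zero_left hi] at hii
  refine (add_le_add_left hle _).trans (le_of_eq ?_)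
  linear_combination -τ * hii
end
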